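/- Let q ∈ k∖{0} be an element that is not a root of unity, and let Λ ∈ M_4(k*) be the multiplicatively antisymmetric matrix with λ_{1,2} = q, λ_{2,1} = q^{-1}, λ_{3,4} = −1, λ_{4,3} = −1, and all other entries equal to 1. Then the quantum torus T = O_Λ((k*)^4) admits no maximal simple quantum subtorus: there exist no integer m ≥ 1 and no multiplicatively antisymmetric M ∈ M_m(k*) such that O_M((k*)^m) is a simple ring and is a maximal quantum subtorus of T. -/

import Mathlib

universe u

/-- A matrix is multiplicatively antisymmetric if `Λ i i = 1` and `Λ i j * Λ j i = 1`
for all `i, j`. -/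
def Matrix.MulAntisymmetric {k : Type u} [Field k] {n : ℕ}
    (Λ : Matrix (Fin n) (Fin n) k) : Prop :=
  (∀ i, Λ i i = 1) ∧ ∀ i j, Λ i j * Λ j i = 1

inductive QTorusRel (k : Type u) [Field k] {n : ℕ} (Λ : Matrix (Fin n) (Fin n) k) :
    FreeAlgebra k (Fin n ⊕ Fin n) → FreeAlgebra k (Fin n ⊕ Fin n) → Prop
  | comm (i j : Fin n) :
      QTorusRel k Λ (FreeAlgebra.ι k (Sum.inl i) * FreeAlgebra.ι k (Sum.inl j))
        (algebraMap k _ (Λ i j) * (FreeAlgebra.ι k (Sum.inl j) * FreeAlgebra.ι k (Sum.inl i)))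
  | mul_inv (i : Fin n) :
      QTorusRel k Λ (FreeAlgebra.ι k (Sum.inl i) * FreeAlgebra.ι k (Sum.inr i)) 1
  | inv_mul (i : Fin n) :
      QTorusRel k Λ (FreeAlgebra.ι k (Sum.inr i) * FreeAlgebra.ι k (Sum.inl i)) 1

/-- The quantum torus `O_Λ((k*)^n)`. -/
def QuantumTorus (k : Type u) [Field k] {n : ℕ} (Λ : Matrix (Fin n) (Fin n) k) :=
  RingQuot (QTorusRel k Λ)

noncomputable instance (k : Type u) [Field k] {n : ℕ} (Λ : Matrix (Fin n) (Fin n) k) :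
    Ring (QuantumTorus k Λ) := by unfold QuantumTorus; infer_instance

noncomputable instance (k : Type u) [Field k] {n : ℕ} (Λ : Matrix (Fin n) (Fin n) k) :
    Algebra k (QuantumTorus k Λ) := by unfold QuantumTorus; infer_instance

/-- The generator `y_i` of the quantum torus. -/
noncomputable def QuantumTorus.y (k : Type u) [Field k] {n : ℕ}
    (Λ : Matrix (Fin n) (Fin n) k) (i : Fin n) : QuantumTorus k Λ :=
  RingQuot.mkAlgHom k (QTorusRel k Λ) (FreeAlgebra.ι k (Sum.inl i))

/-- The generator `y_i⁻¹` of the quantum torus. -/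
noncomputable def QuantumTorus.yinv (k : Type u) [Field k] {n : ℕ}
    (Λ : Matrix (Fin n) (Fin n) k) (i : Fin n) : QuantumTorus k Λ :=
  RingQuot.mkAlgHom k (QTorusRel k Λ) (FreeAlgebra.ι k (Sum.inr i))


/-- `O_Λ((k*)^n)` is a maximal quantum subtorus of the `k`-algebra `A` if it embeds
into `A` and every quantum torus admitting a homomorphic image in `A` admits a
homomorphic image in `O_Λ((k*)^n)`. -/
def IsMaxQuantumSubtorus (k : Type u) [Field k] {n : ℕ} (Λ : Matrix (Fin n) (Fin n) k)
    (A : Type u) [Ring A] [Algebra k A] : Prop :=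
  (∃ f : QuantumTorus k Λ →ₐ[k] A, Function.Injective f) ∧
  ∀ (m : ℕ), 1 ≤ m → ∀ M : Matrix (Fin m) (Fin m) k, M.MulAntisymmetric →
    Nonempty (QuantumTorus k M →ₐ[k] A) →
    Nonempty (QuantumTorus k M →ₐ[k] QuantumTorus k Λ)

namespace QuantumTorus

section General

variable {k : Type u} [Field k] {n : ℕ} {Λ : Matrix (Fin n) (Fin n) k}

theorem y_mul_y (i j : Fin n) : y k Λ i * y k Λ j = Λ i j • (y k Λ j * y k Λ i) := by
  have h := RingQuot.mkAlgHom_rel k (QTorusRel.comm (k := k) (Λ := Λ) i j)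
  rw [map_mul, map_mul, map_mul, AlgHom.commutes] at h
  rw [Algebra.smul_def]
  exact h

theorem y_mul_yinv (i : Fin n) : y k Λ i * yinv k Λ i = 1 := by
  have h := RingQuot.mkAlgHom_rel k (QTorusRel.mul_inv (k := k) (Λ := Λ) i)
  rw [map_mul, map_one] at h
  exact h

theorem yinv_mul_y (i : Fin n) : yinv k Λ i * y k Λ i = 1 := by
  have h := RingQuot.mkAlgHom_rel k (QTorusRel.inv_mul (k := k) (Λ := Λ) i)
  rw [map_mul, map_one] at h
  exact h

variable (Λ) in
/-- The generator `y_i` as a unit. -/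
noncomputable def unit (i : Fin n) : (QuantumTorus k Λ)ˣ :=
  ⟨y k Λ i, yinv k Λ i, y_mul_yinv i, yinv_mul_y i⟩

theorem exists_algHom {A : Type*} [Ring A] [Algebra k A] (u v : Fin n → A)
    (hc : ∀ i j, u i * u j = Λ i j • (u j * u i)) (huv : ∀ i, u i * v i = 1)
    (hvu : ∀ i, v i * u i = 1) :
    ∃ φ : QuantumTorus k Λ →ₐ[k] A, ∀ i, φ (y k Λ i) = u i := by
  have hrel : ∀ ⦃a b⦄, QTorusRel k Λ a b →
      FreeAlgebra.lift k (Sum.elim u v) a = FreeAlgebra.lift k (Sum.elim u v) b := by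
    rintro _ _ (⟨i, j⟩ | i | i)
    · simp [hc i j, Algebra.smul_def]
    · simp [huv]
    · simp [hvu]
  refine ⟨(RingQuot.liftAlgHom k ⟨FreeAlgebra.lift k (Sum.elim u v), hrel⟩ :
    RingQuot (QTorusRel k Λ) →ₐ[k] A), fun i ↦ ?_⟩
  exact (RingQuot.liftAlgHom_mkAlgHom_apply k _ hrel _).trans (by simp)

theorem eq_top_of_mul_mem (p : Submodule k (QuantumTorus k Λ)) (h1 : 1 ∈ p)
    (hy : ∀ i, ∀ s ∈ p, y k Λ i * s ∈ p) (hyinv : ∀ i, ∀ s ∈ p, yinv k Λ i * s ∈ p) :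
    p = ⊤ := by
  have key : ∀ x : FreeAlgebra k (Fin n ⊕ Fin n), ∀ s ∈ p,
      (show QuantumTorus k Λ from RingQuot.mkAlgHom k (QTorusRel k Λ) x) * s ∈ p := by
    intro x
    induction x using FreeAlgebra.induction with
    | grade0 r =>
      intro s hs
      rw [AlgHom.commutes]
      have := p.smul_mem r hs
      rw [Algebra.smul_def] at this
      exact this
    | grade1 i =>
      rcases i with i | i
      · exact hy i
      · exact hyinv i
    | mul a b ha hb =>
      intro s hs
      rw [map_mul]
      have := ha _ (hb s hs)
      rw [← mul_assoc] at this
      exact this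
    | add a b ha hb =>
      intro s hs
      rw [map_add]
      have := p.add_mem (ha s hs) (hb s hs)
      rw [← add_mul] at this
      exact this
  refine eq_top_iff.2 fun t _ ↦ ?_
  obtain ⟨x, rfl⟩ := RingQuot.mkAlgHom_surjective k (QTorusRel k Λ) t
  have := key x 1 h1
  rw [mul_one] at this
  exact this

end General

section TwistedGroupAlgebra

variable {k R G : Type*} [Field k] [Ring R] [Algebra k R] [AddGroup G]
  (b : Module.Basis G k R) {σ : G → G → k}

theorem repr_mul_of_uniqueAdd (hmul : ∀ g h, b g * b h = σ g h • b (g + h)) (x z : R) {g h : G}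
    (hu : UniqueAdd (b.repr x).support (b.repr z).support g h) :
    b.repr (x * z) (g + h) = b.repr x g * b.repr z h * σ g h := by
  classical
  have hxz : x * z = ∑ i ∈ (b.repr x).support, ∑ j ∈ (b.repr z).support,
      (b.repr x i * b.repr z j * σ i j) • b (i + j) := by
    conv_lhs => rw [← b.linearCombination_repr x, ← b.linearCombination_repr z]
    simp only [Finsupp.linearCombination_apply, Finsupp.sum, Finset.sum_mul_sum,
      smul_mul_smul_comm, hmul, smul_smul]
  rw [hxz]
  simp only [map_sum, map_smul, Module.Basis.repr_self, Finsupp.finsetSum_apply,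
    Finsupp.smul_apply, Finsupp.single_apply, smul_eq_mul, mul_ite, mul_one, mul_zero]
  rw [Finset.sum_eq_single g, Finset.sum_eq_single h]
  · simp
  · intro j hj hne
    refine if_neg fun he ↦ hne (add_left_cancel he)
  · intro hh
    simp [Finsupp.notMem_support_iff.1 hh]
  · intro i hi hne
    exact Finset.sum_eq_zero fun j hj ↦ if_neg fun he ↦ hne (hu hi hj he).1
  · intro hg
    simp [Finsupp.notMem_support_iff.1 hg]

theorem exists_eq_smul_of_isUnit [TwoUniqueSums G] (hmul : ∀ g h, b g * b h = σ g h • b (g + h))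
    (hσ : ∀ g h, σ g h ≠ 0) (h1 : b 0 = 1) {x : R} (hx : IsUnit x) :
    ∃ c : k, c ≠ 0 ∧ ∃ g, x = c • b g := by
  classical
  have : Nontrivial R := ⟨b 0, 0, b.ne_zero 0⟩
  obtain ⟨z, hxz⟩ := hx.exists_right_inv
  have hx0 : x ≠ 0 := hx.ne_zero
  have hz0 : z ≠ 0 := by
    rintro rfl
    simp at hxz
  have hA : 0 < (b.repr x).support.card := by simpa [Finset.card_pos] using hx0
  have hB : 0 < (b.repr z).support.card := by simpa [Finset.card_pos] using hz0
  have hcard : ¬ 1 < (b.repr x).support.card * (b.repr z).support.card := by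
    intro hlt
    obtain ⟨p, hp, r, hr, hne, hup, hur⟩ := TwoUniqueSums.uniqueAdd_of_one_lt_card hlt
    have hzero : ∀ s ∈ (b.repr x).support ×ˢ (b.repr z).support,
        UniqueAdd (b.repr x).support (b.repr z).support s.1 s.2 → s.1 + s.2 = 0 := by
      intro s hs hus
      have h := repr_mul_of_uniqueAdd b hmul x z hus
      rw [hxz, ← h1, b.repr_self, Finsupp.single_apply] at h
      rw [Finset.mem_product, Finsupp.mem_support_iff, Finsupp.mem_support_iff] at hs
      by_contra hs0
      rw [if_neg (Ne.symm hs0)] at h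
      exact mul_ne_zero (mul_ne_zero hs.1 hs.2) (hσ _ _) h.symm
    rw [Finset.mem_product] at hp hr
    have h := hup hr.1 hr.2 ((hzero r (Finset.mem_product.2 hr) hur).trans
      (hzero p (Finset.mem_product.2 hp) hup).symm)
    exact hne (Prod.ext h.1.symm h.2.symm)
  have hA1 : (b.repr x).support.card = 1 := by nlinarith
  obtain ⟨g, hg, hrep⟩ := Finsupp.card_support_eq_one.1 hA1
  refine ⟨b.repr x g, hg, g, b.repr.injective ?_⟩
  rw [map_smul, b.repr_self, Finsupp.smul_single, smul_eq_mul, mul_one]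
  exact hrep

end TwistedGroupAlgebra

section Example

variable {k : Type u} [Field k]

/-- The matrix defining the tensor product of the rank two quantum tori at `q` and at `-1`. -/
def exampleMatrix (q : k) : Matrix (Fin 4) (Fin 4) k :=
  !![1, q, 1, 1; q⁻¹, 1, 1, 1; 1, 1, 1, -1; 1, 1, -1, 1]

/-- The cocycle of the example quantum torus with respect to its ordered monomials. -/
def cocycle (q : k) (g h : Fin 4 → ℤ) : k :=
  q ^ (-(g 1 * h 0)) * (-1) ^ (g 3 * h 2)

theorem cocycle_ne_zero {q : k} (hq0 : q ≠ 0) (g h : Fin 4 → ℤ) : cocycle q g h ≠ 0 :=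
  mul_ne_zero (zpow_ne_zero _ hq0) (zpow_ne_zero _ (neg_ne_zero.2 one_ne_zero))

theorem cocycle_add_left {q : k} (hq0 : q ≠ 0) (g g' h : Fin 4 → ℤ) :
    cocycle q (g + g') h = cocycle q g h * cocycle q g' h := by
  have h1 : (-1 : k) ≠ 0 := neg_ne_zero.2 one_ne_zero
  simp only [cocycle, Pi.add_apply, add_mul, neg_add, zpow_add₀ hq0, zpow_add₀ h1]
  ring

theorem cocycle_add_right {q : k} (hq0 : q ≠ 0) (g h h' : Fin 4 → ℤ) :
    cocycle q g (h + h') = cocycle q g h * cocycle q g h' := by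
  have h1 : (-1 : k) ≠ 0 := neg_ne_zero.2 one_ne_zero
  simp only [cocycle, Pi.add_apply, mul_add, neg_add, zpow_add₀ hq0, zpow_add₀ h1]
  ring

/-- The twisted translation operators on finitely supported functions. -/
noncomputable def shift (q : k) (h : Fin 4 → ℤ) : Module.End k ((Fin 4 → ℤ) →₀ k) :=
  Finsupp.linearCombination k fun g ↦ Finsupp.single (h + g) (cocycle q h g)

theorem shift_single (q : k) (h g : Fin 4 → ℤ) (c : k) :
    shift q h (Finsupp.single g c) = Finsupp.single (h + g) (c * cocycle q h g) := by
  simp [shift]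

theorem shift_mul {q : k} (hq0 : q ≠ 0) (g h : Fin 4 → ℤ) :
    shift q g * shift q h = cocycle q g h • shift q (g + h) := by
  refine Finsupp.lhom_ext fun a c ↦ ?_
  simp only [Module.End.mul_apply, LinearMap.smul_apply, shift_single, Finsupp.smul_single,
    cocycle_add_left hq0, cocycle_add_right hq0, add_assoc, smul_eq_mul]
  congr 1
  ring

theorem shift_zero (q : k) : shift q 0 = 1 := by
  refine Finsupp.lhom_ext fun a c ↦ ?_
  simp [shift_single, cocycle]

theorem cocycle_single_single (q : k) (i : Fin 4) (m n : ℤ) :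
    cocycle q (Pi.single i m) (Pi.single i n) = 1 := by
  fin_cases i <;> simp [cocycle]

theorem exists_rep {q : k} (hq0 : q ≠ 0) :
    ∃ φ : QuantumTorus k (exampleMatrix q) →ₐ[k] Module.End k ((Fin 4 → ℤ) →₀ k),
      ∀ i, φ (y k _ i) = shift q (Pi.single i 1) := by
  refine exists_algHom _ (fun i ↦ shift q (Pi.single i (-1))) (fun i j ↦ ?_) (fun i ↦ ?_)
    fun i ↦ ?_
  · rw [shift_mul hq0, shift_mul hq0, smul_smul, add_comm]
    congr 1
    fin_cases i <;> fin_cases j <;> simp [cocycle, exampleMatrix, hq0]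
  · rw [shift_mul hq0, cocycle_single_single, ← Pi.single_add]
    simp [shift_zero]
  · rw [shift_mul hq0, cocycle_single_single, ← Pi.single_add]
    simp [shift_zero]

theorem map_zpow_eq_shift {q : k} (hq0 : q ≠ 0)
    (φ : QuantumTorus k (exampleMatrix q) →ₐ[k] Module.End k ((Fin 4 → ℤ) →₀ k))
    (hφ : ∀ i, φ (y k _ i) = shift q (Pi.single i 1)) (i : Fin 4) (n : ℤ) :
    φ ↑(unit (exampleMatrix q) i ^ n) = shift q (Pi.single i n) := by
  let F : Multiplicative ℤ →* Module.End k ((Fin 4 → ℤ) →₀ k) :=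
    { toFun := fun m ↦ shift q (Pi.single i m.toAdd)
      map_one' := by simp [shift_zero]
      map_mul' := fun a c ↦ by
        rw [shift_mul hq0, cocycle_single_single, one_smul, ← Pi.single_add, toAdd_mul] }
  have h : Units.map (φ : QuantumTorus k (exampleMatrix q) →* _) (unit (exampleMatrix q) i) =
      F.toHomUnits (Multiplicative.ofAdd 1) := Units.ext (hφ i)
  have h' := congrArg (fun u : (Module.End k ((Fin 4 → ℤ) →₀ k))ˣ ↦ (u ^ n).val) h
  simp only [← map_zpow] at h'
  refine h'.trans ?_
  rw [← ofAdd_zsmul]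
  simp [F]

/-- The ordered monomials of the example quantum torus. -/
noncomputable def monomial (q : k) (g : Fin 4 → ℤ) : QuantumTorus k (exampleMatrix q) :=
  ↑(unit (exampleMatrix q) 0 ^ g 0 * unit (exampleMatrix q) 1 ^ g 1 *
    unit (exampleMatrix q) 2 ^ g 2 * unit (exampleMatrix q) 3 ^ g 3)

theorem map_monomial_single_zero {q : k} (hq0 : q ≠ 0)
    (φ : QuantumTorus k (exampleMatrix q) →ₐ[k] Module.End k ((Fin 4 → ℤ) →₀ k))
    (hφ : ∀ i, φ (y k _ i) = shift q (Pi.single i 1)) (g : Fin 4 → ℤ) :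
    φ (monomial q g) (Finsupp.single 0 1) = Finsupp.single g 1 := by
  simp only [monomial, Units.val_mul, map_mul, map_zpow_eq_shift hq0 φ hφ, Module.End.mul_apply,
    shift_single]
  congr 1
  · ext i
    fin_cases i <;> simp
  · simp [cocycle]

theorem linearIndependent_monomial {q : k} (hq0 : q ≠ 0) :
    LinearIndependent k (monomial q) := by
  obtain ⟨φ, hφ⟩ := exists_rep hq0
  refine LinearIndependent.of_comp
    ((LinearMap.applyₗ (Finsupp.single (0 : Fin 4 → ℤ) (1 : k))).comp φ.toLinearMap) ?_
  have h : (fun g ↦ ((LinearMap.applyₗ (Finsupp.single (0 : Fin 4 → ℤ) (1 : k))).comp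
      φ.toLinearMap) (monomial q g)) = fun g ↦ Finsupp.single g (1 : k) :=
    funext fun g ↦ map_monomial_single_zero hq0 φ hφ g
  change LinearIndependent k (fun g ↦ ((LinearMap.applyₗ (Finsupp.single (0 : Fin 4 → ℤ)
    (1 : k))).comp φ.toLinearMap) (monomial q g))
  rw [h]
  exact Finsupp.linearIndependent_single_one k _

theorem zpow_mul_zpow_of_mul_eq {A : Type*} [Ring A] [Algebra k A] {u v : Aˣ} {c : k}
    (hc : c ≠ 0) (h : (u * v : A) = c • (v * u : A)) (m n : ℤ) :
    (↑(u ^ m) * ↑(v ^ n) : A) = c ^ (m * n) • (↑(v ^ n) * ↑(u ^ m) : A) := by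
  set C : Aˣ := Units.map (algebraMap k A : k →* A) (Units.mk0 c hc) with hC
  have hcomm : ∀ w : Aˣ, Commute C w := fun w ↦ Units.ext (Algebra.commutes c (w : A))
  have h1 : u * v * u⁻¹ = C * v := by
    rw [mul_inv_eq_iff_eq_mul]
    ext
    simp [h, hC, Algebra.smul_def, mul_assoc]
  have h2 : u * v ^ n * u⁻¹ = C ^ n * v ^ n := by rw [← conj_zpow, h1, (hcomm v).mul_zpow]
  have h3 : v ^ n * u * (v ^ n)⁻¹ = (C ^ n)⁻¹ * u := by
    rw [mul_inv_eq_iff_eq_mul] at h2 ⊢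
    rw [mul_assoc, h2]
    group
  have h4 : v ^ n * u ^ m * (v ^ n)⁻¹ = (C ^ (m * n))⁻¹ * u ^ m := by
    rw [← conj_zpow, h3, (((hcomm u).zpow_left n).inv_left).mul_zpow, inv_zpow, ← zpow_mul,
      mul_comm n m]
  have h5 : u ^ m * v ^ n = C ^ (m * n) * (v ^ n * u ^ m) := by
    rw [mul_inv_eq_iff_eq_mul] at h4
    rw [h4]
    group
  have h6 := congrArg Units.val h5
  have hCv : ((C ^ (m * n) : Aˣ) : A) = algebraMap k A (c ^ (m * n)) := by
    rw [hC, ← map_zpow, Units.coe_map, Units.val_zpow_eq_zpow_val]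
    rfl
  rw [Units.val_mul, Units.val_mul, Units.val_mul, hCv, ← Algebra.smul_def] at h6
  exact h6

theorem monomial_mul {q : k} (hq0 : q ≠ 0) (g h : Fin 4 → ℤ) :
    monomial q g * monomial q h = cocycle q g h • monomial q (g + h) := by
  have hc : ∀ {i j : Fin 4} {c : k}, c ≠ 0 → exampleMatrix q i j = c → ∀ m n : ℤ,
      (↑(unit (exampleMatrix q) i ^ m) * ↑(unit (exampleMatrix q) j ^ n) :
        QuantumTorus k (exampleMatrix q)) =
      c ^ (m * n) • (↑(unit (exampleMatrix q) j ^ n) * ↑(unit (exampleMatrix q) i ^ m)) :=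
    fun hc0 he ↦ zpow_mul_zpow_of_mul_eq hc0 (he ▸ y_mul_y _ _)
  have h10 := hc (i := 1) (j := 0) (inv_ne_zero hq0) (by simp [exampleMatrix]) (g 1) (h 0)
  have h32 := hc (i := 3) (j := 2) (neg_ne_zero.2 one_ne_zero) (by simp [exampleMatrix])
    (g 3) (h 2)
  have h20 := hc (i := 2) (j := 0) one_ne_zero (by simp [exampleMatrix]) (g 2) (h 0)
  have h30 := hc (i := 3) (j := 0) one_ne_zero (by simp [exampleMatrix]) (g 3) (h 0)
  have h21 := hc (i := 2) (j := 1) one_ne_zero (by simp [exampleMatrix]) (g 2) (h 1)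
  have h31 := hc (i := 3) (j := 1) one_ne_zero (by simp [exampleMatrix]) (g 3) (h 1)
  rw [one_zpow, one_smul] at h20 h30 h21 h31
  rw [inv_zpow, ← zpow_neg] at h10
  simp only [monomial, Pi.add_apply, zpow_add, Units.val_mul, cocycle]
  generalize ((unit (exampleMatrix q) 0 ^ g 0 : (QuantumTorus k (exampleMatrix q))ˣ) :
    QuantumTorus k (exampleMatrix q)) = a0 at *
  generalize ((unit (exampleMatrix q) 1 ^ g 1 : (QuantumTorus k (exampleMatrix q))ˣ) :
    QuantumTorus k (exampleMatrix q)) = a1 at *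
  generalize ((unit (exampleMatrix q) 2 ^ g 2 : (QuantumTorus k (exampleMatrix q))ˣ) :
    QuantumTorus k (exampleMatrix q)) = a2 at *
  generalize ((unit (exampleMatrix q) 3 ^ g 3 : (QuantumTorus k (exampleMatrix q))ˣ) :
    QuantumTorus k (exampleMatrix q)) = a3 at *
  generalize ((unit (exampleMatrix q) 0 ^ h 0 : (QuantumTorus k (exampleMatrix q))ˣ) :
    QuantumTorus k (exampleMatrix q)) = b0 at *
  generalize ((unit (exampleMatrix q) 1 ^ h 1 : (QuantumTorus k (exampleMatrix q))ˣ) :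
    QuantumTorus k (exampleMatrix q)) = b1 at *
  generalize ((unit (exampleMatrix q) 2 ^ h 2 : (QuantumTorus k (exampleMatrix q))ˣ) :
    QuantumTorus k (exampleMatrix q)) = b2 at *
  generalize ((unit (exampleMatrix q) 3 ^ h 3 : (QuantumTorus k (exampleMatrix q))ˣ) :
    QuantumTorus k (exampleMatrix q)) = b3 at *
  calc a0 * a1 * a2 * a3 * (b0 * b1 * b2 * b3)
      = a0 * a1 * a2 * (a3 * b0) * b1 * b2 * b3 := by simp only [mul_assoc]
    _ = a0 * a1 * (a2 * b0) * (a3 * b1) * b2 * b3 := by rw [h30]; simp only [mul_assoc]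
    _ = a0 * (a1 * b0) * (a2 * b1) * (a3 * b2) * b3 := by rw [h20, h31]; simp only [mul_assoc]
    _ = _ := by
      rw [h10, h21, h32]
      simp only [mul_assoc, smul_mul_assoc, mul_smul_comm, smul_smul]
      rw [mul_comm]

theorem monomial_zero (q : k) : monomial q 0 = 1 := by simp [monomial]

theorem monomial_single (q : k) (i : Fin 4) (n : ℤ) :
    monomial q (Pi.single i n) = ↑(unit (exampleMatrix q) i ^ n) := by
  fin_cases i <;> simp [monomial]

theorem span_monomial {q : k} (hq0 : q ≠ 0) :
    Submodule.span k (Set.range (monomial q)) = ⊤ := by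
  have hmul : ∀ g, ∀ s ∈ Submodule.span k (Set.range (monomial q)),
      monomial q g * s ∈ Submodule.span k (Set.range (monomial q)) := by
    intro g s hs
    induction hs using Submodule.span_induction with
    | mem x hx =>
      obtain ⟨h, rfl⟩ := hx
      rw [monomial_mul hq0]
      exact Submodule.smul_mem _ _ (Submodule.subset_span ⟨_, rfl⟩)
    | zero => simp
    | add x z _ _ hx hz => rw [mul_add]; exact Submodule.add_mem _ hx hz
    | smul c x _ hx => rw [mul_smul_comm]; exact Submodule.smul_mem _ _ hx
  refine eq_top_of_mul_mem _ (Submodule.subset_span ⟨0, monomial_zero q⟩) (fun i ↦ ?_) fun i ↦ ?_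
  · have h := hmul (Pi.single i 1)
    rw [monomial_single, zpow_one] at h
    exact h
  · have h := hmul (Pi.single i (-1))
    rw [monomial_single, zpow_neg_one] at h
    exact h

/-- The basis of ordered monomials. -/
noncomputable def monomialBasis {q : k} (hq0 : q ≠ 0) :
    Module.Basis (Fin 4 → ℤ) k (QuantumTorus k (exampleMatrix q)) :=
  Module.Basis.mk (linearIndependent_monomial hq0) (span_monomial hq0).ge

@[simp]
theorem monomialBasis_apply {q : k} (hq0 : q ≠ 0) (g : Fin 4 → ℤ) :
    monomialBasis hq0 g = monomial q g := by
  simp [monomialBasis]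

theorem exists_eq_smul_monomial {q : k} (hq0 : q ≠ 0) {x : QuantumTorus k (exampleMatrix q)}
    (hx : IsUnit x) : ∃ c : k, c ≠ 0 ∧ ∃ g, x = c • monomial q g := by
  simpa using exists_eq_smul_of_isUnit (monomialBasis hq0) (σ := cocycle q)
    (by simpa using monomial_mul hq0) (cocycle_ne_zero hq0) (by simp [monomial_zero]) hx

theorem smul_monomial_sub_one_ne_zero {q : k} (hq0 : q ≠ 0) (c : k) {g : Fin 4 → ℤ} (hg : g ≠ 0) :
    c • monomial q g - 1 ≠ 0 := by
  intro h
  have h' := DFunLike.congr_fun (congrArg (monomialBasis hq0).repr h) 0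
  simp only [← monomial_zero q, ← monomialBasis_apply hq0, map_sub, map_smul,
    Module.Basis.repr_self, Finsupp.sub_apply, Finsupp.smul_apply, Finsupp.single_apply,
    smul_eq_mul, map_zero, Finsupp.zero_apply, if_neg hg] at h'
  simp at h'

theorem not_isUnit_smul_monomial_sub_one {q : k} (hq0 : q ≠ 0) {c : k} (hc : c ≠ 0)
    {g : Fin 4 → ℤ} (hg : g ≠ 0) : ¬ IsUnit (c • monomial q g - 1) := by
  intro hu
  obtain ⟨d, -, h, he⟩ := exists_eq_smul_monomial hq0 hu
  have h' := DFunLike.congr_fun (congrArg (monomialBasis hq0).repr he)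
  simp only [← monomial_zero q, ← monomialBasis_apply hq0, map_sub, map_smul,
    Module.Basis.repr_self, Finsupp.sub_apply, Finsupp.smul_apply, Finsupp.single_apply,
    smul_eq_mul] at h'
  have h0 := h' 0
  have h1 := h' g
  rw [if_neg hg] at h0
  rw [if_neg hg.symm] at h1
  by_cases hh : h = 0
  · subst hh
    simp [hc, hg.symm] at h1
  · simp [hh] at h0

theorem smul_monomial_mul_eq {q : k} (hq0 : q ≠ 0) {c d r : k} (hc : c ≠ 0) (hd : d ≠ 0)
    {g h : Fin 4 → ℤ}
    (he : (c • monomial q g) * (d • monomial q h) =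
      r • ((d • monomial q h) * (c • monomial q g))) :
    cocycle q g h = r * cocycle q h g := by
  have h' := DFunLike.congr_fun (congrArg (monomialBasis hq0).repr he) (g + h)
  simp only [smul_mul_smul_comm, monomial_mul hq0, add_comm h g] at h'
  simp only [← monomialBasis_apply hq0, map_smul, Module.Basis.repr_self, Finsupp.smul_apply,
    Finsupp.single_eq_same, smul_eq_mul, mul_one] at h'
  refine mul_left_cancel₀ (mul_ne_zero hc hd) (h'.trans ?_)
  ring

theorem neg_one_zpow_sq (n : ℤ) : ((-1 : k) ^ n) ^ 2 = 1 := by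
  rw [← zpow_natCast, ← zpow_mul, mul_comm, zpow_mul]
  simp

theorem eq_zero_of_zpow_eq_one {q : k} (hq : ∀ m : ℕ, 0 < m → q ^ m ≠ 1) {e : ℤ}
    (he : q ^ e = 1) : e = 0 := by
  by_contra h0
  refine hq e.natAbs (Int.natAbs_pos.2 h0) ?_
  rw [← zpow_natCast]
  rcases Int.natAbs_eq e with h | h
  · rwa [← h]
  · rw [← neg_eq_iff_eq_neg.2 h, zpow_neg, he, inv_one]

theorem det_eq_of_cocycle {q : k} (hq0 : q ≠ 0) (hq : ∀ m : ℕ, 0 < m → q ^ m ≠ 1)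
    {g h : Fin 4 → ℤ} {r : k} {e : ℤ} (hr : r ^ 2 = (q ^ e) ^ 2)
    (he : cocycle q g h = r * cocycle q h g) : g 0 * h 1 - g 1 * h 0 = e := by
  have h2 := congrArg (fun x ↦ x ^ 2) he
  simp only [cocycle, mul_pow, neg_one_zpow_sq, hr, mul_one] at h2
  simp only [← zpow_natCast, ← zpow_mul, ← zpow_add₀ hq0] at h2
  rw [← div_eq_one_iff_eq (zpow_ne_zero _ hq0), ← zpow_sub₀ hq0] at h2
  have h3 := eq_zero_of_zpow_eq_one hq h2
  push_cast at h3
  linarith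

theorem commute_of_monomial {q : k} (hq0 : q ≠ 0) {v : Fin 4 → ℤ}
    (hv : ∀ h, cocycle q v h = cocycle q h v) (t : QuantumTorus k (exampleMatrix q)) :
    monomial q v * t = t * monomial q v := by
  have ht : t ∈ Submodule.span k (Set.range (monomial q)) := by
    rw [span_monomial hq0]
    trivial
  induction ht using Submodule.span_induction with
  | mem x hx =>
    obtain ⟨h, rfl⟩ := hx
    rw [monomial_mul hq0, monomial_mul hq0, hv, add_comm]
  | zero => simp
  | add x z _ _ hx hz => rw [mul_add, add_mul, hx, hz]
  | smul c x _ hx => rw [mul_smul_comm, smul_mul_assoc, hx]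

theorem mulAntisymmetric_exampleMatrix {q : k} (hq0 : q ≠ 0) :
    (exampleMatrix q).MulAntisymmetric := by
  refine ⟨fun i ↦ ?_, fun i j ↦ ?_⟩
  · fin_cases i <;> simp [exampleMatrix]
  · fin_cases i <;> fin_cases j <;> simp [exampleMatrix, hq0]

/-- Under any endomorphism of the example quantum torus, the square of `y_2` (indices from `0`)
is sent to a central monomial that is not a scalar. -/
theorem exists_map_sq_eq [CharZero k] {q : k} (hq0 : q ≠ 0) (hq : ∀ m : ℕ, 0 < m → q ^ m ≠ 1)
    (ψ : QuantumTorus k (exampleMatrix q) →ₐ[k] QuantumTorus k (exampleMatrix q)) :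
    ∃ c : k, c ≠ 0 ∧ ∃ v : Fin 4 → ℤ, v ≠ 0 ∧ (∀ h, cocycle q v h = cocycle q h v) ∧
      ψ (y k _ 2 ^ 2) = c • monomial q v := by
  have hunit : ∀ i, ∃ c : k, c ≠ 0 ∧ ∃ g, ψ (y k (exampleMatrix q) i) = c • monomial q g :=
    fun i ↦ exists_eq_smul_monomial hq0 (((unit (exampleMatrix q) i).isUnit).map ψ)
  choose c hc g hg using hunit
  have hrel : ∀ i j, cocycle q (g i) (g j) = exampleMatrix q i j * cocycle q (g j) (g i) := by
    intro i j
    refine smul_monomial_mul_eq hq0 (hc i) (hc j) ?_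
    rw [← hg, ← hg, ← map_mul, y_mul_y, map_smul, map_mul]
  have h01 : g 0 0 * g 1 1 - g 0 1 * g 1 0 = 1 :=
    det_eq_of_cocycle hq0 hq (by simp [exampleMatrix]) (hrel 0 1)
  have h02 : g 0 0 * g 2 1 - g 0 1 * g 2 0 = 0 :=
    det_eq_of_cocycle hq0 hq (by simp [exampleMatrix]) (hrel 0 2)
  have h12 : g 1 0 * g 2 1 - g 1 1 * g 2 0 = 0 :=
    det_eq_of_cocycle hq0 hq (by simp [exampleMatrix]) (hrel 1 2)
  have h20 : g 2 0 = 0 := by linear_combination (-g 2 0) * h01 + g 1 0 * h02 - g 0 0 * h12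
  have h21 : g 2 1 = 0 := by linear_combination (-g 2 1) * h01 + g 1 1 * h02 - g 0 1 * h12
  refine ⟨c 2 * c 2 * cocycle q (g 2) (g 2),
    mul_ne_zero (mul_ne_zero (hc 2) (hc 2)) (cocycle_ne_zero hq0 _ _), g 2 + g 2, ?_, ?_, ?_⟩
  · intro h0
    have h2 : g 2 = 0 := by
      funext i
      have := congrFun h0 i
      simp only [Pi.add_apply, Pi.zero_apply] at this ⊢
      omega
    have h23 := hrel 2 3
    simp [h2, cocycle, exampleMatrix] at h23
    norm_num [eq_neg_iff_add_eq_zero] at h23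
  · intro h
    rw [cocycle_add_left hq0, cocycle_add_right hq0]
    simp only [cocycle, h20, h21, zero_mul, mul_zero, neg_zero, zpow_zero, one_mul]
    rw [← sq, ← sq, neg_one_zpow_sq, neg_one_zpow_sq]
  · rw [sq, map_mul, hg, smul_mul_smul_comm, monomial_mul hq0, smul_smul]

end Example

end QuantumTorus

theorem isUnit_of_mem_center_of_ne_zero {R : Type*} [Ring R] [IsSimpleRing R] {z : R}
    (hz : z ∈ Subring.center R) (h0 : z ≠ 0) : IsUnit z := by
  have hF : IsField (Subring.center R) := IsSimpleRing.isField_center R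
  obtain ⟨w, hw⟩ := hF.mul_inv_cancel (a := ⟨z, hz⟩) fun h ↦ h0 (congrArg Subtype.val h)
  have h1 : z * w = 1 := congrArg Subtype.val hw
  exact ⟨⟨z, w, h1, (Subring.mem_center_iff.1 hz w).trans h1⟩, rfl⟩

/-- For `q` not a root of unity and
`Λ = !![1, q, 1, 1; q⁻¹, 1, 1, 1; 1, 1, 1, -1; 1, 1, -1, 1]`, the quantum torus
`O_Λ((k*)^4)` admits no maximal simple quantum subtorus. -/
theorem stmt11 {k : Type u} [Field k] [CharZero k] (q : k) (hq0 : q ≠ 0)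
    (hq : ∀ m : ℕ, 0 < m → q ^ m ≠ 1)
    (Λ : Matrix (Fin 4) (Fin 4) k)
    (hΛ : Λ = !![1, q, 1, 1; q⁻¹, 1, 1, 1; 1, 1, 1, -1; 1, 1, -1, 1]) :
    ¬ ∃ (m : ℕ) (M : Matrix (Fin m) (Fin m) k), 1 ≤ m ∧ M.MulAntisymmetric ∧
        IsSimpleRing (QuantumTorus k M) ∧
        IsMaxQuantumSubtorus k M (QuantumTorus k Λ) := by
  rintro ⟨m, M, -, -, hsimple, ⟨f, hf⟩, hmax⟩
  change Λ = QuantumTorus.exampleMatrix q at hΛ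
  subst hΛ
  obtain ⟨φ⟩ := hmax 4 (by norm_num) _ (QuantumTorus.mulAntisymmetric_exampleMatrix hq0)
    ⟨AlgHom.id k _⟩
  obtain ⟨c, hc, v, hv0, hv, he⟩ := QuantumTorus.exists_map_sq_eq hq0 hq (f.comp φ)
  rw [AlgHom.comp_apply] at he
  set z := φ (QuantumTorus.y k _ 2 ^ 2)
  have hfz : f (z - 1) = c • QuantumTorus.monomial q v - 1 := by rw [map_sub, map_one, he]
  have hz : z ∈ Subring.center (QuantumTorus k M) := by
    refine Subring.mem_center_iff.2 fun t ↦ hf ?_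
    rw [map_mul, map_mul, he, mul_smul_comm, smul_mul_assoc,
      QuantumTorus.commute_of_monomial hq0 hv]
  have hne : z - 1 ≠ 0 := fun h ↦
    QuantumTorus.smul_monomial_sub_one_ne_zero hq0 c hv0 (by rw [← hfz, h, map_zero])
  have hu := (isUnit_of_mem_center_of_ne_zero (sub_mem hz (one_mem _)) hne).map f
  rw [hfz] at hu
  exact QuantumTorus.not_isUnit_smul_monomial_sub_one hq0 hc hv0 hu
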